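/- arXiv:1611.00115 — 2 statements merged into one kernel-verified Lean document; each statement's English description precedes it below -/
import Mathlib

section
/- Let ω = {ωₙ} be a bounded sequence of positive reals and let Θ(W_ω) be the associated diagonal-type 2-variable weighted shift. Then the toral Aluthge transform and the spherical Aluthge transform of Θ(W_ω) coincide, and both are equal to Θ(W_{ω'}), where ω'ₙ := √(ωₙ ω_{n+1}) for all n ≥ 0. -/
open scoped ComplexOrder
open MeasureTheory ContinuousLinearMap

noncomputable section

/-- The Hilbert space `ℓ²(ℤ₊²)`. -/
abbrev H2 : Type := lp (fun _ : ℕ × ℕ => ℂ) 2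

/-- The canonical orthonormal basis vectors of `ℓ²(ℤ₊²)`. -/
noncomputable def e2 (k : ℕ × ℕ) : H2 := lp.single 2 k 1

/-- Bounded operators on `ℓ²(ℤ₊²)` are determined by their values on the canonical basis. -/
theorem H2.clm_ext {A B : H2 →L[ℂ] H2} (h : ∀ k, A (e2 k) = B (e2 k)) : A = B := by
  refine lp.ext_continuousLinearMap (by norm_num) fun k => ?_
  ext : 1
  simpa [e2] using h k

theorem mul_rpow_quarter_eq_sqrt {a b : ℝ} (ha : 0 < a) (hb : 0 < b) :
    a * ((2 * b ^ 2) / (2 * a ^ 2)) ^ ((1 : ℝ) / 4) = √(a * b) := by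
  have hq : (2 * b ^ 2) / (2 * a ^ 2) = (b / a) ^ (2 : ℝ) := by
    rw [Real.rpow_two]
    field_simp
  have hab : a * b = a ^ 2 * (b / a) := by
    field_simp
  rw [hq, ← Real.rpow_mul (by positivity), hab, Real.sqrt_mul (by positivity),
    Real.sqrt_sq ha.le, Real.sqrt_eq_rpow]
  norm_num

/-- For the diagonal-type shift `Θ(W_ω)` (weights `α_k = β_k = ω_{k₁+k₂}`), the toral
Aluthge transform `(S₁,S₂)` and the spherical Aluthge transform `(R₁,R₂)` coincide, and
both equal `Θ(W_{ω'})` (the pair `(V₁,V₂)`), where `ω'ₙ = √(ωₙ ω_{n+1})`. -/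
theorem theta_toral_eq_spherical_eq_theta_sqrt
    (ω : ℕ → ℝ) (hω : ∀ n, 0 < ω n) (hbdd : ∃ M : ℝ, ∀ n, ω n ≤ M)
    (T₁ T₂ S₁ S₂ R₁ R₂ V₁ V₂ : H2 →L[ℂ] H2)
    -- Θ(W_ω):
    (hT₁ : ∀ k : ℕ × ℕ, T₁ (e2 k) = (ω (k.1 + k.2) : ℂ) • e2 (k.1 + 1, k.2))
    (hT₂ : ∀ k : ℕ × ℕ, T₂ (e2 k) = (ω (k.1 + k.2) : ℂ) • e2 (k.1, k.2 + 1))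
    -- toral Aluthge transform of Θ(W_ω):
    (hS₁ : ∀ k : ℕ × ℕ,
      S₁ (e2 k) = (Real.sqrt (ω (k.1 + k.2) * ω (k.1 + 1 + k.2)) : ℂ) • e2 (k.1 + 1, k.2))
    (hS₂ : ∀ k : ℕ × ℕ,
      S₂ (e2 k) = (Real.sqrt (ω (k.1 + k.2) * ω (k.1 + (k.2 + 1))) : ℂ) • e2 (k.1, k.2 + 1))
    -- spherical Aluthge transform of Θ(W_ω)  (here Q_k = 2 ω_{k₁+k₂}²):
    (hR₁ : ∀ k : ℕ × ℕ,
      R₁ (e2 k) = ((ω (k.1 + k.2) *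
        ((2 * (ω (k.1 + 1 + k.2)) ^ 2) / (2 * (ω (k.1 + k.2)) ^ 2)) ^ ((1 : ℝ) / 4) : ℝ) : ℂ)
          • e2 (k.1 + 1, k.2))
    (hR₂ : ∀ k : ℕ × ℕ,
      R₂ (e2 k) = ((ω (k.1 + k.2) *
        ((2 * (ω (k.1 + (k.2 + 1))) ^ 2) / (2 * (ω (k.1 + k.2)) ^ 2)) ^ ((1 : ℝ) / 4) : ℝ) : ℂ)
          • e2 (k.1, k.2 + 1))
    -- Θ(W_{ω'}) where ω'ₙ = √(ωₙ ω_{n+1}):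
    (hV₁ : ∀ k : ℕ × ℕ,
      V₁ (e2 k) = (Real.sqrt (ω (k.1 + k.2) * ω (k.1 + k.2 + 1)) : ℂ) • e2 (k.1 + 1, k.2))
    (hV₂ : ∀ k : ℕ × ℕ,
      V₂ (e2 k) = (Real.sqrt (ω (k.1 + k.2) * ω (k.1 + k.2 + 1)) : ℂ) • e2 (k.1, k.2 + 1)) :
    S₁ = R₁ ∧ S₂ = R₂ ∧ S₁ = V₁ ∧ S₂ = V₂ := by
  have h₁ (k : ℕ × ℕ) : k.1 + 1 + k.2 = k.1 + k.2 + 1 := by ring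
  have h₂ (k : ℕ × ℕ) : k.1 + (k.2 + 1) = k.1 + k.2 + 1 := by ring
  refine ⟨H2.clm_ext fun k => ?_, H2.clm_ext fun k => ?_, H2.clm_ext fun k => ?_,
    H2.clm_ext fun k => ?_⟩
  · rw [hS₁, hR₁, mul_rpow_quarter_eq_sqrt (hω _) (hω _)]
  · rw [hS₂, hR₂, mul_rpow_quarter_eq_sqrt (hω _) (hω _)]
  · rw [hS₁, hV₁, h₁]
  · rw [hS₂, hV₂, h₂]
end
end

section
/- Every spherically quasinormal commuting 2-variable weighted shift is subnormal. That is, if W_{(α,β)} = (T₁,T₂) is a commuting 2-variable weighted shift with positive bounded weights satisfying α_{(k₁,k₂)}² + β_{(k₁,k₂)}² = C for all (k₁,k₂) and some constant C > 0 (equivalently, T₁*T₁ + T₂*T₂ = C·I), then there exists a compactly supported positive Borel measure μ on [0,∞)² such that ‖T₂^{k₂}T₁^{k₁}e_{(0,0)}‖² = ∫ s^{k₁}t^{k₂} dμ(s,t) for all k₁,k₂ ≥ 0. -/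
open scoped ComplexOrder
open MeasureTheory ContinuousLinearMap

noncomputable section

section HausdorffMoment

open Finset Filter Topology

/-- Points of `[0,1]` obtained by clamping the quotient `i / N`. -/
def gridPoint (N i : ℕ) : unitInterval :=
  Set.projIcc 0 1 zero_le_one ((i : ℝ) / N)

lemma coe_gridPoint {N i : ℕ} (h : i ≤ N) : (gridPoint N i : ℝ) = (i : ℝ) / N := by
  have hmem : (i : ℝ) / N ∈ Set.Icc (0 : ℝ) 1 :=
    ⟨by positivity, div_le_one_of_le₀ (by exact_mod_cast h) (by positivity)⟩
  rw [gridPoint, Set.projIcc_of_mem zero_le_one hmem]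

/-- Iterating `g n m = g (n + 1) m + g n (m + 1)` yields a binomial expansion. -/
lemma sum_choose_mul_of_pascal {g : ℕ → ℕ → ℝ}
    (hg : ∀ n m, g (n + 1) m + g n (m + 1) = g n m) (N n m : ℕ) :
    ∑ p ∈ antidiagonal N, (N.choose p.1 : ℝ) * g (n + p.1) (m + p.2) = g n m := by
  induction N generalizing n m with
  | zero => simp
  | succ N ih =>
    rw [Finset.sum_antidiagonal_choose_succ_mul (fun i j => g (n + i) (m + j)), ← hg n m,
      ← ih (n + 1) m, ← ih n (m + 1), add_comm]
    congr 1
    · refine sum_congr rfl fun p hp => ?_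
      rw [← Nat.choose_symm_of_eq_add (mem_antidiagonal.mp hp).symm]
      congr 2
      omega
    · refine sum_congr rfl fun p _ => ?_
      congr 2
      omega

/-- The factorial moments of the Bernstein weights attached to a Pascal-type array. -/
lemma sum_choose_mul_descFactorial_of_pascal {g : ℕ → ℕ → ℝ}
    (hg : ∀ n m, g (n + 1) m + g n (m + 1) = g n m) (n N a : ℕ) :
    ∑ p ∈ antidiagonal N, (N.choose p.1 : ℝ) * g (a + p.1) p.2 * (p.1.descFactorial n : ℝ)
      = (N.descFactorial n : ℝ) * g (a + n) 0 := by
  induction n generalizing N a with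
  | zero => simpa using sum_choose_mul_of_pascal hg N a 0
  | succ n ih =>
    cases N with
    | zero => simp
    | succ N =>
      rw [Finset.Nat.sum_antidiagonal_succ, Nat.zero_descFactorial_succ,
        Nat.succ_descFactorial_succ, Nat.cast_mul, mul_assoc _ _ (g _ 0),
        show a + (n + 1) = a + 1 + n by omega, ← ih N (a + 1), mul_sum]
      simp only [Nat.cast_zero, mul_zero, zero_add]
      refine sum_congr rfl fun p _ => ?_
      have h := congrArg (Nat.cast (R := ℝ)) (Nat.add_one_mul_choose_eq N p.1)
      rw [Nat.succ_descFactorial_succ, show a + (p.1 + 1) = a + 1 + p.1 by omega]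
      push_cast at h ⊢
      linear_combination (-g (a + 1 + p.1) p.2 * (p.1.descFactorial n : ℝ)) * h

/-- Ratios of falling factorials are uniformly close to powers. -/
lemma abs_descFactorial_div_sub_pow_le {N n i : ℕ} (hn : n ≤ N) (hi : i ≤ N) :
    |(i.descFactorial n : ℝ) / (N.descFactorial n : ℝ) - ((i : ℝ) / N) ^ n| ≤ (n : ℝ) ^ 2 / N := by
  induction n with
  | zero => simp
  | succ n ih =>
    have hN : (0 : ℝ) < N := by exact_mod_cast (by omega : 0 < N)
    have hiN : (i : ℝ) ≤ N := by exact_mod_cast hi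
    have hx0 : (0 : ℝ) ≤ (i : ℝ) / N := by positivity
    have hx1 : (i : ℝ) / N ≤ 1 := (div_le_one hN).mpr hiN
    rcases lt_or_ge i (n + 1) with hlt | hge
    · rw [Nat.descFactorial_eq_zero_iff_lt.mpr hlt, Nat.cast_zero, zero_div, zero_sub, abs_neg,
        abs_of_nonneg (by positivity)]
      have hin : (i : ℝ) ≤ n := by exact_mod_cast Nat.lt_succ_iff.mp hlt
      calc ((i : ℝ) / N) ^ (n + 1) ≤ (i : ℝ) / N := pow_le_of_le_one hx0 hx1 (by omega)
        _ ≤ ((n + 1 : ℕ) : ℝ) ^ 2 / N := by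
          gcongr
          push_cast
          nlinarith [(Nat.cast_nonneg n : (0 : ℝ) ≤ n)]
    · have hNn : (0 : ℝ) < (N : ℝ) - n := by
        rw [sub_pos]; exact_mod_cast hn
      have hin : (n : ℝ) ≤ i := by exact_mod_cast (by omega : n ≤ i)
      have hD : (0 : ℝ) < (N.descFactorial n : ℝ) := by
        exact_mod_cast Nat.descFactorial_pos.mpr (by omega : n ≤ N)
      have hratio : |((i : ℝ) - n) / (N - n)| ≤ 1 := by
        rw [abs_of_nonneg (div_nonneg (by linarith) hNn.le), div_le_one hNn]
        linarith
      have hdiff : |((i : ℝ) - n) / (N - n) - (i : ℝ) / N| ≤ (n : ℝ) / N := by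
        have heq : ((i : ℝ) - n) / (N - n) - (i : ℝ) / N
            = -((n : ℝ) / N * ((N - i) / (N - n))) := by
          field_simp
          ring
        rw [heq, abs_neg, abs_of_nonneg
          (mul_nonneg (by positivity) (div_nonneg (by linarith) hNn.le))]
        refine mul_le_of_le_one_right (by positivity) ((div_le_one hNn).mpr ?_)
        linarith
      have hpow : |((i : ℝ) / N) ^ n| ≤ 1 := by
        rw [abs_of_nonneg (by positivity)]
        exact pow_le_one₀ hx0 hx1
      have hsplit : ((i.descFactorial (n + 1) : ℕ) : ℝ) / ((N.descFactorial (n + 1) : ℕ) : ℝ)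
            - ((i : ℝ) / N) ^ (n + 1)
          = ((i.descFactorial n : ℝ) / N.descFactorial n - ((i : ℝ) / N) ^ n)
              * (((i : ℝ) - n) / (N - n))
            + ((i : ℝ) / N) ^ n * (((i : ℝ) - n) / (N - n) - (i : ℝ) / N) := by
        rw [Nat.descFactorial_succ, Nat.descFactorial_succ, Nat.cast_mul, Nat.cast_mul,
          Nat.cast_sub (by omega), Nat.cast_sub (by omega), mul_div_mul_comm]
        ring
      rw [hsplit]
      calc _ ≤ _ := abs_add_le _ _
        _ ≤ (n : ℝ) ^ 2 / N * 1 + 1 * ((n : ℝ) / N) := by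
          rw [abs_mul, abs_mul]
          exact add_le_add
            (mul_le_mul (ih (by omega)) hratio (abs_nonneg _) (by positivity))
            (mul_le_mul hpow hdiff (abs_nonneg _) zero_le_one)
        _ ≤ ((n + 1 : ℕ) : ℝ) ^ 2 / N := by
          rw [mul_one, one_mul, ← add_div]
          gcongr
          push_cast
          nlinarith [(Nat.cast_nonneg n : (0 : ℝ) ≤ n)]

/-- The discrete measure with Bernstein weights attached to an array `g`. -/
def bernsteinMeasure (g : ℕ → ℕ → ℝ) (N : ℕ) : Measure unitInterval :=
  ∑ p ∈ antidiagonal N,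
    ENNReal.ofReal ((N.choose p.1 : ℝ) * g p.1 p.2) • Measure.dirac (gridPoint N p.1)

lemma isProbabilityMeasure_bernsteinMeasure {g : ℕ → ℕ → ℝ}
    (hg0 : ∀ n m, 0 ≤ g n m) (hg1 : g 0 0 = 1)
    (hg : ∀ n m, g (n + 1) m + g n (m + 1) = g n m) (N : ℕ) :
    IsProbabilityMeasure (bernsteinMeasure g N) := by
  constructor
  simp only [bernsteinMeasure, Measure.coe_finsetSum, Finset.sum_apply, Measure.smul_apply,
    measure_univ, smul_eq_mul, mul_one]
  rw [← ENNReal.ofReal_sum_of_nonneg fun p _ => mul_nonneg (Nat.cast_nonneg _) (hg0 _ _)]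
  have h := sum_choose_mul_of_pascal hg N 0 0
  simp only [zero_add] at h
  rw [h, hg1, ENNReal.ofReal_one]

lemma integral_bernsteinMeasure {g : ℕ → ℕ → ℝ} (hg0 : ∀ n m, 0 ≤ g n m) (N : ℕ)
    (f : unitInterval → ℝ) :
    ∫ x, f x ∂bernsteinMeasure g N
      = ∑ p ∈ antidiagonal N, (N.choose p.1 : ℝ) * g p.1 p.2 * f (gridPoint N p.1) := by
  rw [bernsteinMeasure, integral_finsetSum_measure]
  · refine sum_congr rfl fun p _ => ?_
    rw [integral_smul_measure, integral_dirac,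
      ENNReal.toReal_ofReal (mul_nonneg (Nat.cast_nonneg _) (hg0 _ _)), smul_eq_mul]
  · exact fun p _ => (integrable_dirac (by simp)).smul_measure ENNReal.ofReal_ne_top

lemma tendsto_integral_pow_bernsteinMeasure {g : ℕ → ℕ → ℝ}
    (hg0 : ∀ n m, 0 ≤ g n m) (hg1 : g 0 0 = 1)
    (hg : ∀ n m, g (n + 1) m + g n (m + 1) = g n m) (n : ℕ) :
    Tendsto (fun N => ∫ x : unitInterval, (x : ℝ) ^ n ∂bernsteinMeasure g N) atTop
      (𝓝 (g n 0)) := by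
  have hlim : Tendsto (fun N : ℕ => (n : ℝ) ^ 2 / N) atTop (𝓝 0) :=
    tendsto_const_div_atTop_nhds_zero_nat _
  refine tendsto_iff_dist_tendsto_zero.mpr (squeeze_zero' (.of_forall fun _ => dist_nonneg) ?_ hlim)
  filter_upwards [eventually_ge_atTop n] with N hN
  have hD : (N.descFactorial n : ℝ) ≠ 0 := by
    exact_mod_cast (Nat.descFactorial_pos.mpr hN).ne'
  have hmom := sum_choose_mul_descFactorial_of_pascal hg n N 0
  have hone := sum_choose_mul_of_pascal hg N 0 0
  simp only [zero_add] at hmom hone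
  rw [hg1] at hone
  have hgn : g n 0 = ∑ p ∈ antidiagonal N, (N.choose p.1 : ℝ) * g p.1 p.2
      * ((p.1.descFactorial n : ℝ) / N.descFactorial n) := by
    simp only [← mul_div_assoc]
    rw [← sum_div, hmom, mul_div_cancel_left₀ _ hD]
  rw [dist_comm, Real.dist_eq, integral_bernsteinMeasure hg0 N, hgn,
    ← sum_sub_distrib]
  calc _ ≤ _ := abs_sum_le_sum_abs _ _
    _ ≤ ∑ p ∈ antidiagonal N, (N.choose p.1 : ℝ) * g p.1 p.2 * ((n : ℝ) ^ 2 / N) := by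
      refine sum_le_sum fun p hp => ?_
      have hw : 0 ≤ (N.choose p.1 : ℝ) * g p.1 p.2 := mul_nonneg (Nat.cast_nonneg _) (hg0 _ _)
      have hpN : p.1 ≤ N := Nat.le.intro (mem_antidiagonal.mp hp)
      rw [← mul_sub, abs_mul, abs_of_nonneg hw, coe_gridPoint hpN]
      exact mul_le_mul_of_nonneg_left (abs_descFactorial_div_sub_pow_le hN hpN) hw
    _ = (n : ℝ) ^ 2 / N := by rw [← sum_mul, hone, one_mul]

/-- **Hausdorff moment theorem**: a nonnegative array with `g n m = g (n + 1) m + g n (m + 1)`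
consists of the mixed moments of a probability measure on `[0,1]`. -/
theorem exists_probabilityMeasure_moments_of_pascal {g : ℕ → ℕ → ℝ}
    (hg0 : ∀ n m, 0 ≤ g n m) (hg1 : g 0 0 = 1)
    (hg : ∀ n m, g (n + 1) m + g n (m + 1) = g n m) :
    ∃ ν : Measure unitInterval, IsProbabilityMeasure ν ∧
      ∀ n m, ∫ x : unitInterval, (x : ℝ) ^ n * (1 - (x : ℝ)) ^ m ∂ν = g n m := by
  let P (N : ℕ) : ProbabilityMeasure unitInterval :=
    ⟨bernsteinMeasure g N, isProbabilityMeasure_bernsteinMeasure hg0 hg1 hg N⟩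
  obtain ⟨ν, -, hν⟩ := isCompact_univ.ultrafilter_le_nhds ((hyperfilter ℕ).map P) (by simp)
  have hlim : Tendsto P (hyperfilter ℕ : Filter ℕ) (𝓝 ν) := hν
  rw [ProbabilityMeasure.tendsto_iff_forall_integral_tendsto] at hlim
  refine ⟨ν, inferInstance, fun n m => ?_⟩
  have hint (f : unitInterval → ℝ) (hf : Continuous f) : Integrable f (ν : Measure unitInterval) :=
    hf.integrable_of_hasCompactSupport (.of_compactSpace f)
  induction m generalizing n with
  | zero =>
    have h := hlim (BoundedContinuousFunction.mkOfCompact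
      ⟨fun x : unitInterval => (x : ℝ) ^ n, by fun_prop⟩)
    simp only [pow_zero, mul_one]
    refine tendsto_nhds_unique h ?_
    exact (tendsto_integral_pow_bernsteinMeasure hg0 hg1 hg n).mono_left
      Nat.hyperfilter_le_atTop
  | succ m ih =>
    rw [← add_sub_cancel_left (g (n + 1) m) (g n (m + 1)), hg, ← ih n, ← ih (n + 1),
      ← integral_sub (hint _ (by fun_prop)) (hint _ (by fun_prop))]
    congr 1
    ext x
    ring

end HausdorffMoment

lemma norm_e2 (k : ℕ × ℕ) : ‖e2 k‖ = 1 := by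
  simp [e2, lp.norm_single]

/-- Corollary 2.12: every spherically quasinormal commuting 2-variable weighted shift is
subnormal: if `α_k² + β_k² = C > 0` for all `k`, then there is a compactly supported
positive Borel measure `μ` on `[0,∞)²` interpolating the moments (a Berger measure). -/
theorem spherically_quasinormal_implies_subnormal
    (α β : ℕ × ℕ → ℝ)
    (hα : ∀ k, 0 < α k) (hβ : ∀ k, 0 < β k)
    (hbdd : ∃ M : ℝ, ∀ k, α k ≤ M ∧ β k ≤ M)
    (T₁ T₂ : H2 →L[ℂ] H2)
    (hT₁ : ∀ k : ℕ × ℕ, T₁ (e2 k) = (α k : ℂ) • e2 (k.1 + 1, k.2))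
    (hT₂ : ∀ k : ℕ × ℕ, T₂ (e2 k) = (β k : ℂ) • e2 (k.1, k.2 + 1))
    (hcomm : T₁ * T₂ = T₂ * T₁)
    (C : ℝ) (hC : 0 < C)
    (hquasi : ∀ k : ℕ × ℕ, (α k) ^ 2 + (β k) ^ 2 = C) :
    ∃ μ : Measure (ℝ × ℝ),
      (∃ K : Set (ℝ × ℝ), IsCompact K ∧ μ Kᶜ = 0) ∧
      μ {p : ℝ × ℝ | ¬ (0 ≤ p.1 ∧ 0 ≤ p.2)} = 0 ∧
      ∀ k₁ k₂ : ℕ,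
        ‖(T₂ ^ k₂) ((T₁ ^ k₁) (e2 (0, 0)))‖ ^ 2 = ∫ p : ℝ × ℝ, p.1 ^ k₁ * p.2 ^ k₂ ∂μ := by
  have hc : Commute T₁ T₂ := hcomm
  have hsucc₂ (n m : ℕ) : (T₂ ^ (m + 1)) ((T₁ ^ n) (e2 (0, 0)))
      = T₂ ((T₂ ^ m) ((T₁ ^ n) (e2 (0, 0)))) := by
    rw [pow_succ']; rfl
  have hsucc₁ (n m : ℕ) : (T₂ ^ m) ((T₁ ^ (n + 1)) (e2 (0, 0)))
      = T₁ ((T₂ ^ m) ((T₁ ^ n) (e2 (0, 0)))) := by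
    have h : T₂ ^ m * T₁ ^ (n + 1) = T₁ * (T₂ ^ m * T₁ ^ n) := by
      rw [pow_succ', ← mul_assoc, ← mul_assoc, (hc.pow_right m).eq]
    exact congrArg (fun S : H2 →L[ℂ] H2 => S (e2 (0, 0))) h
  have hbasis (n m : ℕ) : ∃ c : ℂ, (T₂ ^ m) ((T₁ ^ n) (e2 (0, 0))) = c • e2 (n, m) := by
    induction m with
    | zero =>
      induction n with
      | zero => exact ⟨1, by simp⟩
      | succ n ih =>
        obtain ⟨c, hcn⟩ := ih
        exact ⟨c * α (n, 0), by rw [hsucc₁, hcn, map_smul, hT₁, smul_smul]⟩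
    | succ m ih =>
      obtain ⟨c, hcm⟩ := ih
      exact ⟨c * β (n, m), by rw [hsucc₂, hcm, map_smul, hT₂, smul_smul]⟩
  let G (n m : ℕ) : ℝ := ‖(T₂ ^ m) ((T₁ ^ n) (e2 (0, 0)))‖ ^ 2
  have hG (n m : ℕ) : G (n + 1) m + G n (m + 1) = C * G n m := by
    obtain ⟨c, hcnm⟩ := hbasis n m
    simp only [G]
    rw [hsucc₁, hsucc₂, hcnm, map_smul, map_smul, hT₁, hT₂, ← hquasi (n, m)]
    simp only [norm_smul, norm_e2, Complex.norm_real, Real.norm_eq_abs, mul_one, mul_pow, sq_abs]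
    ring
  obtain ⟨ν, hν, hmom⟩ := exists_probabilityMeasure_moments_of_pascal
    (g := fun n m => G n m / C ^ (n + m)) (fun n m => by positivity)
    (by simp [G, norm_e2])
    (fun n m => by
      rw [show n + 1 + m = n + m + 1 by omega, show n + (m + 1) = n + m + 1 by omega, ← add_div,
        hG, pow_succ', mul_div_mul_left _ _ hC.ne'])
  let φ : unitInterval → ℝ × ℝ := fun x => (C * x, C * (1 - x))
  have hφ : Continuous φ := by fun_prop
  refine ⟨ν.map φ, ⟨Set.range φ, isCompact_range hφ, ?_⟩, ?_, fun n m => ?_⟩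
  · rw [Measure.map_apply hφ.measurable (isCompact_range hφ).measurableSet.compl]
    simp
  · have hmeas : MeasurableSet {p : ℝ × ℝ | ¬ (0 ≤ p.1 ∧ 0 ≤ p.2)} :=
      ((measurableSet_le measurable_const measurable_fst).inter
        (measurableSet_le measurable_const measurable_snd)).compl
    rw [Measure.map_apply hφ.measurable hmeas]
    convert measure_empty (μ := ν)
    refine Set.eq_empty_of_forall_notMem fun x hx => hx ⟨?_, ?_⟩
    · exact mul_nonneg hC.le x.2.1
    · exact mul_nonneg hC.le (sub_nonneg.mpr x.2.2)
  · have hcont : Continuous fun p : ℝ × ℝ => p.1 ^ n * p.2 ^ m := by fun_prop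
    rw [integral_map hφ.aemeasurable hcont.aestronglyMeasurable]
    have hfac (x : unitInterval) : (φ x).1 ^ n * (φ x).2 ^ m
        = C ^ (n + m) * ((x : ℝ) ^ n * (1 - (x : ℝ)) ^ m) := by
      simp only [φ, mul_pow, pow_add]
      ring
    simp only [hfac]
    rw [integral_const_mul, hmom, mul_div_cancel₀ _ (by positivity)]
end
end
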